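/- Let q be a complex number with |q| < 1. Then Σ_{i,j≥0} (−1)^(T(i−j)) · q^(3i²+2ij+3j²) / ((q⁴;q⁴)_i · (q⁴;q⁴)_j) = 1 / ((q⁸;q⁴⁰)_∞ · (q³²;q⁴⁰)_∞), where for an integer t, T(t) = t(t−1)/2. (This is the Chen–Yin identity Σ_{i,j≥0} (−1)^(T(i−j)) q^(3i²/4+ij/2+3j²/4) / ((q;q)_i (q;q)_j) = 1/(q², q⁸; q¹⁰)_∞ after the substitution q ↦ q⁴.) -/

import Mathlib

/-- Finite q-Pochhammer symbol `(a; q)_n = ∏_{k=0}^{n-1} (1 - a q^k)`. -/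
noncomputable def qPoch (a q : ℂ) (n : ℕ) : ℂ := ∏ k ∈ Finset.range n, (1 - a * q ^ k)

/-- Infinite q-Pochhammer symbol `(a; q)_∞ = ∏_{k=0}^{∞} (1 - a q^k)`. -/
noncomputable def qPochInf (a q : ℂ) : ℂ := ∏' k : ℕ, (1 - a * q ^ k)

/-- The sign `(-1)^(T(i-j))` where `T(t) = t(t-1)/2` is computed in the integers. -/
noncomputable def signT (i j : ℕ) : ℂ :=
  (-1 : ℂ) ^ ((((i : ℤ) - j) * ((i : ℤ) - j - 1)) / 2)

/-- The reciprocal `1 / (q; q)_n`, extended by zero to negative `n`. -/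
noncomputable def qPochInv (q : ℂ) (n : ℤ) : ℂ := if 0 ≤ n then (qPoch q q n.toNat)⁻¹ else 0

/-- The coefficient `z ^ m * q ^ (m * (m - 1) / 2)` of a theta series. -/
noncomputable def thetaCoeff (z q : ℂ) (m : ℤ) : ℂ := z ^ m * q ^ (m * (m - 1) / 2)

theorem qPoch_zero (a q : ℂ) : qPoch a q 0 = 1 := by simp [qPoch]

theorem qPoch_succ (a q : ℂ) (n : ℕ) : qPoch a q (n + 1) = qPoch a q n * (1 - a * q ^ n) := by
  simp [qPoch, Finset.prod_range_succ]

theorem norm_pow_lt_one {q : ℂ} (hq : ‖q‖ < 1) {n : ℕ} (hn : n ≠ 0) : ‖q ^ n‖ < 1 := by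
  rw [norm_pow]
  exact pow_lt_one₀ (norm_nonneg _) hq hn

theorem one_sub_pow_succ_ne_zero {q : ℂ} (hq : ‖q‖ < 1) (n : ℕ) : 1 - q ^ (n + 1) ≠ 0 := by
  intro h
  have h1 : ‖q ^ (n + 1)‖ = 1 := by rw [← sub_eq_zero.mp h, norm_one]
  rw [norm_pow] at h1
  exact absurd h1 (pow_lt_one₀ (norm_nonneg _) hq (by omega)).ne

theorem qPochInv_of_neg (q : ℂ) {n : ℤ} (hn : n < 0) : qPochInv q n = 0 := by
  simp [qPochInv, hn]

theorem qPochInv_natCast (q : ℂ) (n : ℕ) : qPochInv q n = (qPoch q q n)⁻¹ := by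
  simp [qPochInv]

theorem qPochInv_zero (q : ℂ) : qPochInv q 0 = 1 := by
  simp [qPochInv, qPoch_zero]

theorem one_sub_mul_qPochInv_succ {q : ℂ} (hq : ‖q‖ < 1) (n : ℤ) :
    (1 - q ^ (n + 1)) * qPochInv q (n + 1) = qPochInv q n := by
  rcases lt_trichotomy n (-1) with h | rfl | h
  · rw [qPochInv_of_neg q (by omega), qPochInv_of_neg q (by omega), mul_zero]
  · simp [qPochInv_of_neg]
  · lift n to ℕ using (by omega)
    have h := one_sub_pow_succ_ne_zero hq n
    have e : ((n : ℤ) + 1) = ((n + 1 : ℕ) : ℤ) := by push_cast; rfl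
    rw [e, qPochInv_natCast, qPochInv_natCast, qPoch_succ, zpow_natCast, mul_inv,
      ← pow_succ']
    field_simp

theorem one_sub_mul_qPochInv {q : ℂ} (hq : ‖q‖ < 1) (n : ℤ) :
    (1 - q ^ n) * qPochInv q n = qPochInv q (n - 1) := by
  have := one_sub_mul_qPochInv_succ hq (n - 1)
  rwa [sub_add_cancel] at this

theorem thetaCoeff_succ {z q : ℂ} (hz : z ≠ 0) (hq0 : q ≠ 0) (m : ℤ) :
    thetaCoeff z q (m + 1) = z * q ^ m * thetaCoeff z q m := by
  have e : (m + 1) * (m + 1 - 1) / 2 = m + m * (m - 1) / 2 := by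
    rw [show (m + 1) * (m + 1 - 1) = m * (m - 1) + 2 * m by ring]
    omega
  rw [thetaCoeff, thetaCoeff, e, zpow_add₀ hq0, zpow_add_one₀ hz]
  ring

theorem summable_mul_qPochInv (q : ℂ) (c : ℤ → ℂ) (A B : ℤ) :
    Summable fun m ↦ c m * (qPochInv q (A - m) * qPochInv q (B + m)) := by
  refine summable_of_ne_finset_zero (s := Finset.Icc (-B) A) fun m hm ↦ ?_
  rw [Finset.mem_Icc, not_and_or] at hm
  rcases hm with h | h
  · rw [qPochInv_of_neg q (n := B + m) (by omega)]; simp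
  · rw [qPochInv_of_neg q (n := A - m) (by omega)]; simp

theorem tsum_int_add_one (f : ℤ → ℂ) : ∑' m, f (m + 1) = ∑' m, f m :=
  (Equiv.addRight (1 : ℤ)).tsum_eq f

theorem tsum_add_mul_qPochInv {q : ℂ} (hq : ‖q‖ < 1) (a b : ℤ → ℂ) (A B : ℤ) :
    ∑' m, (a m * (1 - q ^ (A + 1 - m)) + b m * (1 - q ^ (B + m))) *
        (qPochInv q (A + 1 - m) * qPochInv q (B + m)) =
      ∑' m, (a m + b (m + 1)) * (qPochInv q (A - m) * qPochInv q (B + m)) := by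
  have h (m : ℤ) : (a m * (1 - q ^ (A + 1 - m)) + b m * (1 - q ^ (B + m))) *
        (qPochInv q (A + 1 - m) * qPochInv q (B + m)) =
      a m * (qPochInv q (A - m) * qPochInv q (B + m)) +
      b m * (qPochInv q (A + 1 - m) * qPochInv q (B - 1 + m)) := by
    have h1 := one_sub_mul_qPochInv hq (A + 1 - m)
    have h2 := one_sub_mul_qPochInv hq (B + m)
    rw [show A + 1 - m - 1 = A - m by ring] at h1
    rw [show B + m - 1 = B - 1 + m by ring] at h2
    rw [← h1, ← h2]
    ring
  have hb : ∑' m, b m * (qPochInv q (A + 1 - m) * qPochInv q (B - 1 + m)) =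
      ∑' m, b (m + 1) * (qPochInv q (A - m) * qPochInv q (B + m)) := by
    rw [← tsum_int_add_one]
    refine tsum_congr fun m ↦ ?_
    rw [show A + 1 - (m + 1) = A - m by ring, show B - 1 + (m + 1) = B + m by ring]
  rw [tsum_congr h, Summable.tsum_add (summable_mul_qPochInv q a A B)
    (summable_mul_qPochInv q b (A + 1) (B - 1)), hb, ← Summable.tsum_add
    (summable_mul_qPochInv q a A B) (summable_mul_qPochInv q (fun m ↦ b (m + 1)) A B)]
  exact tsum_congr fun m ↦ (add_mul ..).symm

theorem tsum_mul_qPochInv_neg (q : ℂ) (c : ℤ → ℂ) (A B : ℤ) :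
    ∑' m, c (-m) * (qPochInv q (B - m) * qPochInv q (A + m)) =
      ∑' m, c m * (qPochInv q (A - m) * qPochInv q (B + m)) := by
  rw [← (Equiv.neg ℤ).tsum_eq]
  refine tsum_congr fun m ↦ ?_
  simp only [Equiv.neg_apply, neg_neg, sub_neg_eq_add, ← sub_eq_add_neg]
  ring

theorem thetaCoeff_neg {z q : ℂ} (hq0 : q ≠ 0) (m : ℤ) :
    thetaCoeff z q (-m) = thetaCoeff (q / z) q m := by
  have e : -m * (-m - 1) / 2 = m + m * (m - 1) / 2 := by
    rw [show -m * (-m - 1) = m * (m - 1) + 2 * m by ring]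
    omega
  rw [thetaCoeff, thetaCoeff, e, zpow_add₀ hq0, div_zpow, zpow_neg]
  ring

theorem tsum_thetaCoeff_succ_left {z q : ℂ} (hz : z ≠ 0) (hq0 : q ≠ 0) (hq : ‖q‖ < 1)
    (A B : ℤ) :
    (1 - q ^ (A + B + 1)) *
        ∑' m, thetaCoeff z q m * (qPochInv q (A + 1 - m) * qPochInv q (B + m)) =
      (1 + z * q ^ A) * ∑' m, thetaCoeff z q m * (qPochInv q (A - m) * qPochInv q (B + m)) := by
  have h := tsum_add_mul_qPochInv hq (thetaCoeff z q)
    (fun m ↦ q ^ (A + 1 - m) * thetaCoeff z q m) A B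
  rw [← tsum_mul_left, ← tsum_mul_left]
  refine (tsum_congr fun m ↦ ?_).trans (h.trans (tsum_congr fun m ↦ ?_))
  · rw [show A + B + 1 = (A + 1 - m) + (B + m) by ring, zpow_add₀ hq0]
    ring
  · rw [thetaCoeff_succ hz hq0, show A + 1 - (m + 1) = A - m by ring, zpow_sub₀ hq0]
    have := zpow_ne_zero m hq0
    field_simp

/-- A finite form of the Jacobi triple product identity. -/
theorem tsum_thetaCoeff_mul_qPochInv {z q : ℂ} (hz : z ≠ 0) (hq0 : q ≠ 0) (hq : ‖q‖ < 1)
    (A B : ℕ) :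
    ∑' m, thetaCoeff (-z) q m * (qPochInv q (A - m) * qPochInv q (B + m)) =
      qPoch z q A * qPoch (q / z) q B * qPochInv q (A + B) := by
  have hz' : -z ≠ 0 := neg_ne_zero.mpr hz
  induction A with
  | succ A ih =>
    have h := tsum_thetaCoeff_succ_left hz' hq0 hq A B
    have hw := one_sub_mul_qPochInv_succ hq (A + B)
    have hne : 1 - q ^ ((A : ℤ) + B + 1) ≠ 0 := mod_cast one_sub_pow_succ_ne_zero hq (A + B)
    refine mul_left_cancel₀ hne ?_
    push_cast
    rw [h, ih, ← hw, qPoch_succ, zpow_natCast, show (A : ℤ) + 1 + B = A + B + 1 by ring]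
    ring
  | zero =>
    induction B with
    | zero =>
      rw [tsum_eq_single 0]
      · simp [thetaCoeff, qPochInv_zero, qPoch_zero]
      · intro m hm
        rcases lt_or_gt_of_ne hm with h | h
        · rw [qPochInv_of_neg q (n := ((0 : ℕ) : ℤ) + m) (by omega)]; simp
        · rw [qPochInv_of_neg q (n := ((0 : ℕ) : ℤ) - m) (by omega)]; simp
    | succ B ih =>
      have h := tsum_thetaCoeff_succ_left (div_ne_zero hq0 hz') hq0 hq B 0
      have hw := one_sub_mul_qPochInv_succ hq B
      have hne : 1 - q ^ ((B : ℤ) + 1) ≠ 0 := mod_cast one_sub_pow_succ_ne_zero hq B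
      refine mul_left_cancel₀ hne ?_
      rw [← tsum_mul_qPochInv_neg] at ih ⊢
      simp only [thetaCoeff_neg hq0, add_zero] at h ih ⊢
      push_cast at ih ⊢
      rw [h, ih, qPoch_succ, zpow_natCast]
      simp only [zero_add]
      rw [← hw, div_neg]
      ring

/-- A finite form of Durfee's square identity. -/
theorem tsum_durfee {q : ℂ} (hq0 : q ≠ 0) (hq : ‖q‖ < 1) (M b : ℤ) :
    ∑' r, q ^ (r * (r + b)) * qPochInv q (r + b) * (qPochInv q (M - r) * qPochInv q (0 + r)) =
      qPochInv q M * qPochInv q (M + b) := by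
  rcases lt_or_ge M 0 with hM | hM
  · rw [qPochInv_of_neg q hM, zero_mul]
    refine (tsum_congr fun r ↦ ?_).trans tsum_zero
    rcases lt_or_ge r 0 with h | h
    · rw [qPochInv_of_neg q (n := 0 + r) (by omega)]; simp
    · rw [qPochInv_of_neg q (n := M - r) (by omega)]; simp
  lift M to ℕ using hM
  induction M generalizing b with
  | zero =>
    rw [tsum_eq_single 0]
    · simp [qPochInv_zero]
    · intro m hm
      rcases lt_or_gt_of_ne hm with h | h
      · rw [qPochInv_of_neg q (n := 0 + m) (by omega)]; simp
      · rw [qPochInv_of_neg q (n := ((0 : ℕ) : ℤ) - m) (by omega)]; simp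
  | succ M ih =>
    have hne : 1 - q ^ ((M : ℤ) + 1) ≠ 0 := mod_cast one_sub_pow_succ_ne_zero hq M
    refine mul_left_cancel₀ hne ?_
    push_cast
    have h := tsum_add_mul_qPochInv hq
      (fun r ↦ q ^ r * (q ^ (r * (r + b)) * qPochInv q (r + b)))
      (fun r ↦ q ^ (r * (r + b)) * qPochInv q (r + b)) M 0
    have hw := one_sub_mul_qPochInv_succ hq M
    rw [← mul_assoc, hw, show (M : ℤ) + 1 + b = M + (b + 1) by ring, ← ih, ← tsum_mul_left]
    refine (tsum_congr fun r ↦ ?_).trans (h.trans (tsum_congr fun r ↦ ?_))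
    · rw [show (M : ℤ) + 1 = (M + 1 - r) + (0 + r) by ring, zpow_add₀ hq0]
      simp only [zero_add, sub_add_cancel]
      ring
    · have hw := one_sub_mul_qPochInv_succ hq (r + b)
      rw [← hw, show r * (r + (b + 1)) = r + r * (r + b) by ring,
        show (r + 1) * (r + 1 + b) = (r + b + 1) + (r + r * (r + b)) by ring,
        zpow_add₀ hq0 (r + b + 1) (r + r * (r + b)), zpow_add₀ hq0 r (r * (r + b)),
        show r + 1 + b = r + b + 1 by ring, show r + (b + 1) = r + b + 1 by ring]
      ring

/-- The limiting case of Bailey's lemma. -/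
theorem tsum_bailey {q : ℂ} (hq0 : q ≠ 0) (hq : ‖q‖ < 1) (c : ℤ → ℂ) (N : ℤ) :
    ∑' m, c m * q ^ (m ^ 2) * (qPochInv q (N - m) * qPochInv q (N + m)) =
      ∑' s, q ^ (s ^ 2) * qPochInv q (N - s) *
        ∑' m, c m * (qPochInv q (s - m) * qPochInv q (s + m)) := by
  simp_rw [← tsum_mul_left]
  rw [Summable.tsum_comm (f := fun m s ↦ q ^ (s ^ 2) * qPochInv q (N - s) *
    (c m * (qPochInv q (s - m) * qPochInv q (s + m))))]
  · refine tsum_congr fun m ↦ ?_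
    have h := tsum_durfee hq0 hq (N - m) (2 * m)
    rw [show N - m + 2 * m = N + m by ring] at h
    rw [← h, ← tsum_mul_left,
      ← (Equiv.addRight m).tsum_eq fun s ↦ q ^ (s ^ 2) * _ * _]
    refine tsum_congr fun r ↦ ?_
    simp only [Equiv.coe_addRight, zero_add]
    rw [show (r + m) ^ 2 = m ^ 2 + r * (r + 2 * m) by ring, zpow_add₀ hq0,
      show N - (r + m) = N - m - r by ring, show r + m - m = r by ring,
      show r + m + m = r + 2 * m by ring]
    ring
  · refine summable_of_ne_finset_zero (s := Finset.Icc (-N) N ×ˢ Finset.Icc 0 N) ?_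
    rintro ⟨m, s⟩ h
    simp only [Finset.mem_product, Finset.mem_Icc, Function.uncurry_apply_pair] at h ⊢
    by_cases h1 : N - s < 0
    · rw [qPochInv_of_neg q h1]; simp
    by_cases h2 : s - m < 0
    · rw [qPochInv_of_neg q h2]; simp
    by_cases h3 : s + m < 0
    · rw [qPochInv_of_neg q h3]; simp
    omega

theorem tsum_neg_one_zpow_mul_qPochInv {q : ℂ} (hq0 : q ≠ 0) (hq : ‖q‖ < 1) (N : ℤ) :
    ∑' m, (-1) ^ m * q ^ (m ^ 2) * (qPochInv q (N - m) * qPochInv q (N + m)) =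
      qPochInv (q ^ 2) N := by
  have hq2 := norm_pow_lt_one hq two_ne_zero
  rcases lt_or_ge N 0 with hN | hN
  · rw [qPochInv_of_neg _ hN]
    refine (tsum_congr fun m ↦ ?_).trans tsum_zero
    rcases lt_or_ge m 0 with h | h
    · rw [qPochInv_of_neg q (n := N + m) (by omega)]; simp
    · rw [qPochInv_of_neg q (n := N - m) (by omega)]; simp
  lift N to ℕ using hN
  induction N with
  | zero =>
    rw [tsum_eq_single 0]
    · simp [qPochInv_zero]
    · intro m hm
      rcases lt_or_gt_of_ne hm with h | h
      · rw [qPochInv_of_neg q (n := ((0 : ℕ) : ℤ) + m) (by omega)]; simp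
      · rw [qPochInv_of_neg q (n := ((0 : ℕ) : ℤ) - m) (by omega)]; simp
  | succ N ih =>
    have hne : 1 - (q ^ 2) ^ ((N : ℤ) + 1) ≠ 0 := mod_cast one_sub_pow_succ_ne_zero hq2 N
    refine mul_left_cancel₀ hne ?_
    push_cast
    rw [one_sub_mul_qPochInv_succ hq2, ← ih, ← tsum_mul_left]
    set c : ℤ → ℂ := fun m ↦ (-1) ^ m * q ^ (m ^ 2) * q ^ (N + 1 + m) with hc
    have h0 : ∑' m, c m * (qPochInv q (N - m) * qPochInv q (N + 1 + m)) = 0 := by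
      rw [← self_eq_neg, ← tsum_neg, ← ((Equiv.neg ℤ).trans (Equiv.subRight 1)).tsum_eq]
      refine tsum_congr fun m ↦ ?_
      simp only [hc, Equiv.trans_apply, Equiv.neg_apply, Equiv.subRight_apply]
      rw [show (N : ℤ) - (-m - 1) = N + 1 + m by ring,
        show (N : ℤ) + 1 + (-m - 1) = N - m by ring, mul_assoc _ (q ^ _) (q ^ _),
        mul_assoc _ (q ^ _) (q ^ _), ← zpow_add₀ hq0, ← zpow_add₀ hq0,
        show (-m - 1) ^ 2 + ((N : ℤ) - m) = m ^ 2 + (N + 1 + m) by ring,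
        zpow_sub_one₀ (by norm_num), zpow_neg, ← inv_zpow, inv_neg_one]
      ring
    have h1 := tsum_mul_qPochInv_neg q c N (N + 1)
    rw [h0] at h1
    have key (m : ℤ) : (1 - (q ^ 2) ^ ((N : ℤ) + 1)) * ((-1) ^ m * q ^ (m ^ 2) *
          (qPochInv q (N + 1 - m) * qPochInv q (N + 1 + m))) =
        (-1) ^ m * q ^ (m ^ 2) * (qPochInv q (N - m) * qPochInv q (N + m)) +
        (c m * (qPochInv q (N - m) * qPochInv q (N + 1 + m)) +
          c (-m) * (qPochInv q (N + 1 - m) * qPochInv q (N + m))) := by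
      have e1 := one_sub_mul_qPochInv_succ hq (N - m)
      have e2 := one_sub_mul_qPochInv_succ hq (N + m)
      rw [show (N : ℤ) - m + 1 = N + 1 - m by ring] at e1
      rw [show (N : ℤ) + m + 1 = N + 1 + m by ring] at e2
      have e3 : (q ^ 2) ^ ((N : ℤ) + 1) = q ^ ((N : ℤ) + 1 - m) * q ^ ((N : ℤ) + 1 + m) := by
        rw [← zpow_natCast, ← zpow_mul, ← zpow_add₀ hq0]
        congr 1
        push_cast
        ring
      simp only [hc]
      rw [← e1, ← e2, e3, neg_sq, zpow_neg, ← inv_zpow, inv_neg_one,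
        ← sub_eq_add_neg]
      ring
    rw [tsum_congr key, Summable.tsum_add, Summable.tsum_add, h0, h1, add_zero, add_zero]
    · exact summable_mul_qPochInv q c N (N + 1)
    · exact summable_mul_qPochInv q (fun m ↦ c (-m)) (N + 1) N
    · exact summable_mul_qPochInv q (fun m ↦ (-1) ^ m * q ^ (m ^ 2)) N N
    · exact (summable_mul_qPochInv q c N (N + 1)).add
        (summable_mul_qPochInv q (fun m ↦ c (-m)) (N + 1) N)

theorem tsum_thetaCoeff_neg_one {q : ℂ} (hq0 : q ≠ 0) (hq : ‖q‖ < 1) (s : ℤ) :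
    ∑' m, thetaCoeff (-1) q m * (qPochInv q (s - m) * qPochInv q (s + m)) =
      if s = 0 then 1 else 0 := by
  rcases lt_or_ge s 0 with hs | hs
  · rw [if_neg hs.ne]
    refine (tsum_congr fun m ↦ ?_).trans tsum_zero
    rcases lt_or_ge m 0 with h | h
    · rw [qPochInv_of_neg q (n := s + m) (by omega)]; simp
    · rw [qPochInv_of_neg q (n := s - m) (by omega)]; simp
  lift s to ℕ using hs
  rw [tsum_thetaCoeff_mul_qPochInv one_ne_zero hq0 hq]
  rcases s with _ | s
  · simp [qPoch_zero, qPochInv_zero]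
  · have : qPoch 1 q (s + 1) = 0 := Finset.prod_eq_zero (i := 0) (by simp) (by simp)
    rw [this, if_neg (by omega)]
    ring

/-- A finite form of the first Rogers-Ramanujan identity. -/
theorem tsum_rogersRamanujan_finite {q : ℂ} (hq0 : q ≠ 0) (hq : ‖q‖ < 1) (N : ℤ) :
    ∑' m, thetaCoeff (-q ^ 2) (q ^ 5) m * (qPochInv q (N - m) * qPochInv q (N + m)) =
      ∑' s, q ^ (s ^ 2) * qPochInv q (N - s) * qPochInv q s := by
  have h (s : ℤ) : ∑' m, thetaCoeff (-1) q m * q ^ (m ^ 2) *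
      (qPochInv q (s - m) * qPochInv q (s + m)) = qPochInv q s := by
    rw [tsum_bailey hq0 hq, tsum_eq_single 0]
    · rw [tsum_thetaCoeff_neg_one hq0 hq]
      simp
    · intro t ht
      rw [tsum_thetaCoeff_neg_one hq0 hq, if_neg ht, mul_zero]
  rw [← tsum_congr fun s ↦ congrArg (q ^ (s ^ 2) * qPochInv q (N - s) * ·) (h s),
    ← tsum_bailey hq0 hq]
  refine tsum_congr fun m ↦ ?_
  have e : 5 * (m * (m - 1) / 2) + 2 * m = m * (m - 1) / 2 + m ^ 2 + m ^ 2 := by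
    have : 2 * (m * (m - 1) / 2) = m * (m - 1) :=
      Int.two_mul_ediv_two_of_even (Int.even_mul_pred_self m)
    linear_combination 2 * this
  congr 1
  rw [thetaCoeff, thetaCoeff, mul_assoc, mul_assoc, ← zpow_add₀ hq0, ← zpow_add₀ hq0, ← add_assoc,
    ← e, zpow_add₀ hq0, zpow_mul, zpow_mul, neg_eq_neg_one_mul (q ^ 2), mul_zpow]
  norm_cast
  ring

open Filter Topology

theorem summable_norm_mul_pow {q : ℂ} (hq : ‖q‖ < 1) (a : ℂ) :
    Summable fun k : ℕ ↦ ‖-(a * q ^ k)‖ := by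
  simpa only [norm_neg, norm_mul, norm_pow] using
    (summable_geometric_of_lt_one (norm_nonneg q) hq).mul_left ‖a‖

theorem tendsto_qPoch {q : ℂ} (hq : ‖q‖ < 1) (a : ℂ) :
    Tendsto (qPoch a q) atTop (𝓝 (qPochInf a q)) := by
  have := multipliable_one_add_of_summable (summable_norm_mul_pow hq a)
  simp only [← sub_eq_add_neg] at this
  exact this.tendsto_prod_tprod_nat

theorem qPochInf_ne_zero {a q : ℂ} (hq : ‖q‖ < 1) (ha : ‖a‖ < 1) : qPochInf a q ≠ 0 := by
  have := tprod_one_add_ne_zero_of_summable (f := fun k ↦ -(a * q ^ k)) (fun k h ↦ ?_)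
    (summable_norm_mul_pow hq a)
  · simpa only [qPochInf, ← sub_eq_add_neg] using this
  · have h1 : ‖a * q ^ k‖ = 1 := by
      rw [← sub_eq_add_neg, sub_eq_zero] at h
      rw [← h, norm_one]
    rw [norm_mul, norm_pow] at h1
    have := mul_lt_one_of_nonneg_of_lt_one_left (norm_nonneg a) ha
      (pow_le_one₀ (n := k) (norm_nonneg q) hq.le)
    exact this.ne h1

theorem tendsto_qPochInv {q : ℂ} (hq : ‖q‖ < 1) :
    Tendsto (qPochInv q) atTop (𝓝 (qPochInf q q)⁻¹) := by
  have ht : Tendsto Int.toNat atTop atTop :=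
    tendsto_atTop_atTop.mpr fun b ↦ ⟨b, fun a h ↦ by omega⟩
  have h := ((tendsto_qPoch hq q).inv₀ (qPochInf_ne_zero hq hq)).comp ht
  refine h.congr' ?_
  filter_upwards [eventually_ge_atTop 0] with n hn
  simp [qPochInv, hn]

theorem exists_norm_qPochInv_le {q : ℂ} (hq : ‖q‖ < 1) : ∃ C, ∀ n, ‖qPochInv q n‖ ≤ C := by
  obtain ⟨C, hC⟩ := ((tendsto_qPoch hq q).inv₀ (qPochInf_ne_zero hq hq)).norm.bddAbove_range
  refine ⟨C, fun n ↦ ?_⟩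
  have h (k : ℕ) : ‖(qPoch q q k)⁻¹‖ ≤ C := hC ⟨k, rfl⟩
  rcases lt_or_ge n 0 with hn | hn
  · rw [qPochInv_of_neg q hn, norm_zero]
    exact (norm_nonneg _).trans (h 0)
  · lift n to ℕ using hn
    rw [qPochInv_natCast]
    exact h n

theorem tendsto_qPochInv_add {q : ℂ} (hq : ‖q‖ < 1) (m : ℤ) :
    Tendsto (fun N : ℕ ↦ qPochInv q (N + m)) atTop (𝓝 (qPochInf q q)⁻¹) :=
  (tendsto_qPochInv hq).comp
    (tendsto_atTop_add_const_right _ m tendsto_natCast_atTop_atTop)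

theorem tendsto_tsum_mul_qPochInv {q : ℂ} (hq : ‖q‖ < 1) {c : ℤ → ℂ} (hc : Summable c) :
    Tendsto (fun N : ℕ ↦ ∑' m, c m * (qPochInv q (N - m) * qPochInv q (N + m))) atTop
      (𝓝 ((∑' m, c m) * ((qPochInf q q)⁻¹ * (qPochInf q q)⁻¹))) := by
  obtain ⟨C, hC⟩ := exists_norm_qPochInv_le hq
  have hC0 : 0 ≤ C := (norm_nonneg _).trans (hC 0)
  rw [← tsum_mul_right]
  refine tendsto_tsum_of_dominated_convergence (hc.norm.mul_right (C * C)) (fun m ↦ ?_)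
    (.of_forall fun N m ↦ ?_)
  · exact ((tendsto_qPochInv_add hq (-m)).mul (tendsto_qPochInv_add hq m)).const_mul _
  · rw [norm_mul, norm_mul]
    gcongr <;> exact hC _

theorem summable_thetaCoeff_nat {z q : ℂ} (hz : z ≠ 0) (hq0 : q ≠ 0) (hq : ‖q‖ < 1) :
    Summable fun n : ℕ ↦ thetaCoeff z q n := by
  have hne (m : ℤ) : thetaCoeff z q m ≠ 0 :=
    mul_ne_zero (zpow_ne_zero _ hz) (zpow_ne_zero _ hq0)
  refine summable_of_ratio_test_tendsto_lt_one zero_lt_one (.of_forall fun n ↦ hne n) ?_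
  have h : Tendsto (fun n : ℕ ↦ ‖z * q ^ n‖) atTop (𝓝 0) := by
    simpa using ((tendsto_pow_atTop_nhds_zero_of_norm_lt_one hq).const_mul z).norm
  refine h.congr fun n ↦ ?_
  push_cast
  rw [thetaCoeff_succ hz hq0, zpow_natCast, norm_mul (z * q ^ n),
    mul_div_cancel_right₀ _ (norm_ne_zero_iff.mpr (hne n))]

theorem summable_thetaCoeff {z q : ℂ} (hz : z ≠ 0) (hq0 : q ≠ 0) (hq : ‖q‖ < 1) :
    Summable (thetaCoeff z q) := by
  refine .of_nat_of_neg (summable_thetaCoeff_nat hz hq0 hq) ?_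
  simp only [thetaCoeff_neg hq0]
  exact summable_thetaCoeff_nat (div_ne_zero hq0 hz) hq0 hq

/-- The Jacobi triple product identity. -/
theorem tsum_thetaCoeff {z q : ℂ} (hz : z ≠ 0) (hq0 : q ≠ 0) (hq : ‖q‖ < 1) :
    ∑' m, thetaCoeff (-z) q m = qPochInf z q * qPochInf (q / z) q * qPochInf q q := by
  have h1 := tendsto_tsum_mul_qPochInv hq (summable_thetaCoeff (neg_ne_zero.mpr hz) hq0 hq)
  have h2 : Tendsto (fun N : ℕ ↦ qPochInv q (N + N)) atTop (𝓝 (qPochInf q q)⁻¹) :=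
    (tendsto_qPochInv hq).comp
      (tendsto_natCast_atTop_atTop.atTop_add_atTop tendsto_natCast_atTop_atTop)
  simp only [tsum_thetaCoeff_mul_qPochInv hz hq0 hq] at h1
  have h := tendsto_nhds_unique h1 (((tendsto_qPoch hq z).mul (tendsto_qPoch hq (q / z))).mul h2)
  have hne := qPochInf_ne_zero hq hq
  field_simp at h
  linear_combination h

theorem qPoch_five_mul (q : ℂ) (N : ℕ) :
    qPoch q q (5 * N) = qPoch q (q ^ 5) N * qPoch (q ^ 2) (q ^ 5) N * qPoch (q ^ 3) (q ^ 5) N *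
      qPoch (q ^ 4) (q ^ 5) N * qPoch (q ^ 5) (q ^ 5) N := by
  induction N with
  | zero => simp [qPoch_zero]
  | succ N ih =>
    rw [show 5 * (N + 1) = 5 * N + 1 + 1 + 1 + 1 + 1 by ring]
    simp only [qPoch_succ, ih]
    ring

theorem qPochInf_self_eq_five {q : ℂ} (hq : ‖q‖ < 1) :
    qPochInf q q = qPochInf q (q ^ 5) * qPochInf (q ^ 2) (q ^ 5) * qPochInf (q ^ 3) (q ^ 5) *
      qPochInf (q ^ 4) (q ^ 5) * qPochInf (q ^ 5) (q ^ 5) := by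
  have hq5 := norm_pow_lt_one hq (n := 5) (by norm_num)
  have h := (tendsto_qPoch hq q).comp
    (tendsto_id.const_mul_atTop' (show 0 < 5 by norm_num))
  refine tendsto_nhds_unique (h.congr fun N ↦ qPoch_five_mul q N) ?_
  exact ((((tendsto_qPoch hq5 _).mul (tendsto_qPoch hq5 _)).mul (tendsto_qPoch hq5 _)).mul
    (tendsto_qPoch hq5 _)).mul (tendsto_qPoch hq5 _)

theorem summable_zpow_sq {q : ℂ} (hq0 : q ≠ 0) (hq : ‖q‖ < 1) :
    Summable fun s : ℤ ↦ q ^ (s ^ 2) := by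
  refine (summable_thetaCoeff hq0 (pow_ne_zero 2 hq0) (norm_pow_lt_one hq two_ne_zero)).congr
    fun s ↦ ?_
  have : 2 * (s * (s - 1) / 2) = s * (s - 1) :=
    Int.two_mul_ediv_two_of_even (Int.even_mul_pred_self s)
  rw [thetaCoeff, ← zpow_natCast, ← zpow_mul, ← zpow_add₀ hq0]
  congr 1
  push_cast
  rw [this]
  ring

/-- The first Rogers-Ramanujan identity. -/
theorem tsum_rogersRamanujan {q : ℂ} (hq0 : q ≠ 0) (hq : ‖q‖ < 1) :
    ∑' s, q ^ (s ^ 2) * qPochInv q s = 1 / (qPochInf q (q ^ 5) * qPochInf (q ^ 4) (q ^ 5)) := by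
  have hq5 := norm_pow_lt_one hq (n := 5) (by norm_num)
  have h1 := tendsto_tsum_mul_qPochInv hq
    (summable_thetaCoeff (neg_ne_zero.mpr (pow_ne_zero 2 hq0)) (pow_ne_zero 5 hq0) hq5)
  obtain ⟨C, hC⟩ := exists_norm_qPochInv_le hq
  have hC0 : 0 ≤ C := (norm_nonneg _).trans (hC 0)
  have h2 : Tendsto (fun N : ℕ ↦ ∑' s, q ^ (s ^ 2) * qPochInv q (N - s) * qPochInv q s) atTop
      (𝓝 (∑' s, q ^ (s ^ 2) * (qPochInf q q)⁻¹ * qPochInv q s)) := by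
    refine tendsto_tsum_of_dominated_convergence
      (((summable_zpow_sq hq0 hq).norm.mul_right C).mul_right C) (fun s ↦ ?_)
      (.of_forall fun N s ↦ ?_)
    · exact ((tendsto_qPochInv_add hq (-s)).const_mul _).mul_const _
    · rw [norm_mul, norm_mul]
      gcongr <;> exact hC _
  simp only [tsum_rogersRamanujan_finite hq0 hq] at h1
  have h := tendsto_nhds_unique h1 h2
  rw [tsum_thetaCoeff (pow_ne_zero 2 hq0) (pow_ne_zero 5 hq0) hq5,
    show q ^ 5 / q ^ 2 = q ^ 3 by field_simp] at h
  simp_rw [mul_right_comm _ (qPochInf q q)⁻¹] at h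
  rw [tsum_mul_right] at h
  have hne := qPochInf_ne_zero hq hq
  have hprod := qPochInf_self_eq_five hq
  have hn (k : ℕ) (hk : k ≠ 0) := qPochInf_ne_zero hq5 (norm_pow_lt_one hq hk)
  have n1 := qPochInf_ne_zero hq5 hq
  have n2 := hn 2 (by norm_num)
  have n3 := hn 3 (by norm_num)
  have n4 := hn 4 (by norm_num)
  have n5 := hn 5 (by norm_num)
  have h' : ∑' s, q ^ (s ^ 2) * qPochInv q s = qPochInf (q ^ 2) (q ^ 5) *
      qPochInf (q ^ 3) (q ^ 5) * qPochInf (q ^ 5) (q ^ 5) * (qPochInf q q)⁻¹ :=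
    mul_right_cancel₀ (inv_ne_zero hne) (by rw [← h]; ring)
  rw [h', hprod]
  field_simp

theorem summable_pow_div_qPoch {q p : ℂ} (hq : ‖q‖ < 1) (hp : ‖p‖ < 1) (ε : ℕ × ℕ → ℂ)
    (hε : ∀ x, ‖ε x‖ ≤ 1) :
    Summable fun x : ℕ × ℕ ↦ ε x * q ^ (3 * x.1 ^ 2 + 2 * x.1 * x.2 + 3 * x.2 ^ 2) /
      (qPoch p p x.1 * qPoch p p x.2) := by
  obtain ⟨C, hC⟩ := exists_norm_qPochInv_le hp
  have hC0 : 0 ≤ C := (norm_nonneg _).trans (hC 0)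
  have hg := summable_geometric_of_lt_one (norm_nonneg q) hq
  have hs := (hg.mul_of_nonneg hg (fun _ ↦ by positivity) (fun _ ↦ by positivity)).mul_right (C * C)
  refine .of_norm_bounded hs fun x ↦ ?_
  rw [div_eq_mul_inv, mul_inv, ← qPochInv_natCast, ← qPochInv_natCast, norm_mul, norm_mul,
    norm_mul, norm_pow, ← pow_add]
  have hx1 := Nat.le_self_pow two_ne_zero x.1
  have hx2 := Nat.le_self_pow two_ne_zero x.2
  have h1 : ‖q‖ ^ (3 * x.1 ^ 2 + 2 * x.1 * x.2 + 3 * x.2 ^ 2) ≤ ‖q‖ ^ (x.1 + x.2) :=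
    pow_le_pow_of_le_one (norm_nonneg q) hq.le (by nlinarith)
  have h2 : ‖ε x‖ * ‖q‖ ^ (3 * x.1 ^ 2 + 2 * x.1 * x.2 + 3 * x.2 ^ 2) ≤ ‖q‖ ^ (x.1 + x.2) :=
    (mul_le_of_le_one_left (by positivity) (hε x)).trans h1
  gcongr <;> exact hC _

theorem tsum_eq_tsum_of_odd_antisymm {F : ℤ × ℤ → ℂ} (hF : Summable F)
    (hodd : ∀ x, Odd (x.1 - x.2) → F x.swap = -F x) :
    ∑' x, F x = ∑' N, ∑' k, F (N + k, N - k) := by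
  set E : Set (ℤ × ℤ) := {x | Even (x.1 - x.2)} with hE
  have hO : ∑' x, Eᶜ.indicator F x = 0 := by
    rw [← self_eq_neg, ← tsum_neg, ← (Equiv.prodComm ℤ ℤ).tsum_eq]
    refine tsum_congr fun x ↦ ?_
    rw [Equiv.prodComm_apply]
    by_cases hx : Odd (x.1 - x.2)
    · have hx' : Odd (x.swap.1 - x.swap.2) := by
        rw [Prod.fst_swap, Prod.snd_swap, ← neg_sub]
        exact hx.neg
      rw [Set.indicator_of_mem (by simpa [hE] using hx'), Set.indicator_of_mem (by simpa [hE] using hx),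
        hodd x hx]
    · have hx' : ¬ Odd (x.swap.1 - x.swap.2) := by
        rw [Prod.fst_swap, Prod.snd_swap, ← neg_sub]
        rwa [odd_neg]
      rw [Set.indicator_of_notMem (by simpa [hE] using hx'),
        Set.indicator_of_notMem (by simpa [hE] using hx), neg_zero]
  have hinj : Function.Injective fun x : ℤ × ℤ ↦ (x.1 + x.2, x.1 - x.2) := by
    rintro ⟨a, b⟩ ⟨c, d⟩ h
    simp only [Prod.mk.injEq] at h ⊢
    omega
  have hEs : Function.support (E.indicator F) ⊆
      Set.range fun x : ℤ × ℤ ↦ (x.1 + x.2, x.1 - x.2) := by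
    rintro ⟨i, j⟩ h
    obtain ⟨k, hk⟩ := Set.mem_of_indicator_ne_zero h
    refine ⟨(j + k, k), ?_⟩
    simp only [Prod.mk.injEq] at hk ⊢
    omega
  have hmem (x : ℤ × ℤ) : (x.1 + x.2, x.1 - x.2) ∈ E := ⟨x.2, by simp only; ring⟩
  rw [← tsum_congr fun x ↦ congrFun (Set.indicator_self_add_compl E F) x]
  simp only [Pi.add_apply]
  rw [(hF.indicator E).tsum_add (hF.indicator Eᶜ), hO, add_zero, ← hinj.tsum_eq hEs]
  simp only [Set.indicator_of_mem (hmem _)]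
  exact (hF.comp_injective hinj).tsum_prod

theorem neg_one_zpow_triangular_neg {t : ℤ} (ht : Odd t) :
    (-1 : ℂ) ^ (-t * (-t - 1) / 2) = -(-1) ^ (t * (t - 1) / 2) := by
  have e : -t * (-t - 1) / 2 = t + t * (t - 1) / 2 := by
    rw [show -t * (-t - 1) = t * (t - 1) + 2 * t by ring]
    omega
  rw [e, zpow_add₀ (by norm_num), ht.neg_one_zpow, neg_one_mul]

theorem neg_one_zpow_triangular_two_mul (k : ℤ) :
    (-1 : ℂ) ^ (2 * k * (2 * k - 1) / 2) = (-1) ^ k := by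
  have e : 2 * k * (2 * k - 1) / 2 = 2 * (k * (k - 1)) + k := by
    rw [show 2 * k * (2 * k - 1) = 2 * (2 * (k * (k - 1)) + k) by ring]
    omega
  rw [e, zpow_add₀ (by norm_num), (even_two_mul _).neg_one_zpow, one_mul]

theorem stmt_4 (q : ℂ) (hq : ‖q‖ < 1) :
    (∑' p : ℕ × ℕ,
        signT p.1 p.2 * q ^ (3 * p.1 ^ 2 + 2 * p.1 * p.2 + 3 * p.2 ^ 2) /
          (qPoch (q ^ 4) (q ^ 4) p.1 * qPoch (q ^ 4) (q ^ 4) p.2))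
      = 1 / (qPochInf (q ^ 8) (q ^ 40) * qPochInf (q ^ 32) (q ^ 40)) := by
  rcases eq_or_ne q 0 with rfl | hq0
  · rw [tsum_eq_single (0, 0)]
    · simp [signT, qPoch_zero, qPochInf]
    · rintro ⟨i, j⟩ h
      have : 3 * i ^ 2 + 2 * i * j + 3 * j ^ 2 ≠ 0 := by
        contrapose! h
        simp_all
      simp [zero_pow this]
  have hq4 := norm_pow_lt_one hq (n := 4) (by norm_num)
  have hq8 := norm_pow_lt_one hq (n := 8) (by norm_num)
  have hq40 : q ^ 4 ≠ 0 := pow_ne_zero 4 hq0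
  set F : ℤ × ℤ → ℂ := fun x ↦ (-1) ^ ((x.1 - x.2) * (x.1 - x.2 - 1) / 2) *
    q ^ (3 * x.1 ^ 2 + 2 * x.1 * x.2 + 3 * x.2 ^ 2) *
    (qPochInv (q ^ 4) x.1 * qPochInv (q ^ 4) x.2) with hF
  have hinj : Function.Injective fun x : ℕ × ℕ ↦ ((x.1 : ℤ), (x.2 : ℤ)) := by
    rintro ⟨a, b⟩ ⟨c, d⟩ h
    simpa using h
  have hout (x : ℤ × ℤ) (hx : x ∉ Set.range fun x : ℕ × ℕ ↦ ((x.1 : ℤ), (x.2 : ℤ))) :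
      F x = 0 := by
    by_cases h1 : x.1 < 0
    · simp [hF, qPochInv_of_neg _ h1]
    by_cases h2 : x.2 < 0
    · simp [hF, qPochInv_of_neg _ h2]
    refine absurd ⟨(x.1.toNat, x.2.toNat), ?_⟩ hx
    ext <;> simp only <;> omega
  have hcast (x : ℕ × ℕ) : signT x.1 x.2 * q ^ (3 * x.1 ^ 2 + 2 * x.1 * x.2 + 3 * x.2 ^ 2) /
      (qPoch (q ^ 4) (q ^ 4) x.1 * qPoch (q ^ 4) (q ^ 4) x.2) = F ((x.1 : ℤ), (x.2 : ℤ)) := by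
    simp only [hF, signT, qPochInv_natCast]
    rw [div_eq_mul_inv, mul_inv]
    norm_cast
  have hsum : Summable F := by
    rw [← hinj.summable_iff hout]
    refine (summable_pow_div_qPoch hq hq4 (fun x ↦ signT x.1 x.2) fun x ↦ ?_).congr hcast
    simp [signT, norm_zpow]
  rw [tsum_congr hcast, hinj.tsum_eq (f := F) (Function.support_subset_iff'.mpr hout),
    tsum_eq_tsum_of_odd_antisymm hsum]
  · have h := tsum_rogersRamanujan (pow_ne_zero 8 hq0) hq8
    simp only [← pow_mul, Nat.reduceMul] at h
    rw [← h]
    refine tsum_congr fun N ↦ ?_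
    have hN := tsum_neg_one_zpow_mul_qPochInv hq40 hq4 N
    rw [← pow_mul] at hN
    rw [← hN, ← tsum_mul_left]
    refine tsum_congr fun k ↦ ?_
    simp only [hF]
    rw [show N + k - (N - k) = 2 * k by ring, neg_one_zpow_triangular_two_mul,
      show 3 * (N + k) ^ 2 + 2 * (N + k) * (N - k) + 3 * (N - k) ^ 2 =
        8 * N ^ 2 + 4 * k ^ 2 by ring, zpow_add₀ hq0, zpow_mul, zpow_mul]
    norm_cast
    ring
  · intro x hx
    simp only [hF, Prod.fst_swap, Prod.snd_swap]
    rw [← neg_sub x.1 x.2, neg_one_zpow_triangular_neg hx]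
    ring_nf
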